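/- Let ε ∈ (0, 1/7], let c ∈ [0,1], let G be a simple graph on n ≥ 324/ε⁸ vertices, and let S ⊆ V satisfy deg_S(v) ≥ 1 for all v ∈ S and μ_p(S) ≥ ε. Then there exists T ⊆ S such that every v ∈ T has deg_T(v) ≥ ε·n/3, |T| ≥ ε·n/3, and μ_p(T) ≥ μ_p(S) − 2ε. -/

import Mathlib

open scoped Classical
open Finset

/-- `degIn G S v` is the degree of `v` into `S`: the number of neighbors of `v`
lying inside `S`. -/
noncomputable def degIn {V : Type*} (G : SimpleGraph V) (S : Finset V) (v : V) : ℕ :=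
  (S.filter fun u => G.Adj v u).card

/-- `edgesIn G S` is `|E(S)|`: the number of edges of `G` with both endpoints in `S`. -/
noncomputable def edgesIn {V : Type*} [Fintype V] (G : SimpleGraph V) (S : Finset V) : ℕ :=
  (G.edgeFinset.filter fun e => ∀ v ∈ e, v ∈ S).card

/-- `E_max = n(n−1)/2`, the maximum possible number of edges on `n` vertices. -/
noncomputable def Emax (n : ℕ) : ℝ := (n : ℝ) * ((n : ℝ) - 1) / 2

/-- the left term `L(S) = 1 − ∑_{v∈S} c / deg_S(v)` of the principal's objective -/
noncomputable def Lobj {V : Type*} (G : SimpleGraph V) (c : ℝ) (S : Finset V) : ℝ :=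
  1 - ∑ v ∈ S, c / (degIn G S v : ℝ)

/-- the relaxed left term `𝓛(S) = 1 − ∑_{v∈S} c / (deg_S(v) + 1)` -/
noncomputable def Lrel {V : Type*} (G : SimpleGraph V) (c : ℝ) (S : Finset V) : ℝ :=
  1 - ∑ v ∈ S, c / ((degIn G S v : ℝ) + 1)

/-- the right term `R(S) = |E(S)| / E_max` of the principal's objective -/
noncomputable def Robj {V : Type*} [Fintype V] (G : SimpleGraph V) (S : Finset V) : ℝ :=
  (edgesIn G S : ℝ) / Emax (Fintype.card V)

/-- the principal's utility `μ_p(S) = L(S)·R(S)` in the uniform-cost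
graph-supermodular contract problem -/
noncomputable def muP {V : Type*} [Fintype V] (G : SimpleGraph V) (c : ℝ) (S : Finset V) : ℝ :=
  Lobj G c S * Robj G S

section DegreeCore

variable {V : Type*} (G : SimpleGraph V)

/-- Removing `v` lowers the degree of exactly the neighbors of `v`, by one. -/
lemma degIn_erase_add {S : Finset V} {v : V} (hv : v ∈ S) (u : V) :
    degIn G (S.erase v) u + (if G.Adj v u then 1 else 0) = degIn G S u := by
  unfold degIn
  rw [Finset.filter_erase]
  split_ifs with h
  · exact Finset.card_erase_add_one (Finset.mem_filter.2 ⟨hv, h.symm⟩)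
  · rw [Finset.erase_eq_of_notMem (fun hm => h (Finset.mem_filter.1 hm).2.symm), add_zero]

lemma degIn_le_card (S : Finset V) (v : V) : degIn G S v ≤ S.card :=
  Finset.card_filter_le _ _

/-- Removing a vertex of minimum degree does not increase `∑ 1 / (deg + 1)`. -/
lemma sum_inv_degIn_erase_le {S : Finset V} {v : V} (hv : v ∈ S)
    (hmin : ∀ u ∈ S, degIn G S v ≤ degIn G S u) :
    ∑ u ∈ S.erase v, 1 / ((degIn G (S.erase v) u : ℝ) + 1) ≤
      ∑ u ∈ S, 1 / ((degIn G S u : ℝ) + 1) := by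
  set δ : ℝ := (degIn G S v : ℝ)
  have hδ0 : 0 ≤ δ := Nat.cast_nonneg _
  have hpt : ∀ u ∈ S.erase v, 1 / ((degIn G (S.erase v) u : ℝ) + 1) ≤
      1 / ((degIn G S u : ℝ) + 1) + if G.Adj v u then 1 / (δ * (δ + 1)) else 0 := by
    intro u hu
    have hdeg := degIn_erase_add G hv u
    split_ifs with h
    · have hpos : 1 ≤ degIn G S v :=
        Finset.card_pos.2 ⟨u, Finset.mem_filter.2 ⟨Finset.mem_of_mem_erase hu, h⟩⟩
      have hδ1 : 1 ≤ δ := Nat.one_le_cast.2 hpos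
      have hle : δ ≤ (degIn G S u : ℝ) :=
        Nat.cast_le.2 (hmin u (Finset.mem_of_mem_erase hu))
      rw [if_pos h] at hdeg
      have hcast : (degIn G (S.erase v) u : ℝ) + 1 = degIn G S u := by exact_mod_cast hdeg
      rw [hcast]
      generalize (degIn G S u : ℝ) = x at hle
      have hx : 0 < x := by linarith
      have hsub : 1 / x - 1 / (x + 1) = 1 / (x * (x + 1)) := by field_simp; ring
      have hmono : 1 / (x * (x + 1)) ≤ 1 / (δ * (δ + 1)) := by gcongr
      linarith
    · rw [if_neg h, add_zero] at hdeg
      rw [hdeg, add_zero]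
  have hcount : ∑ u ∈ S.erase v, (if G.Adj v u then 1 / (δ * (δ + 1)) else 0) ≤
      1 / (δ + 1) := by
    rw [← Finset.sum_filter, Finset.sum_const, nsmul_eq_mul]
    have hcard : (((S.erase v).filter fun u => G.Adj v u).card : ℝ) ≤ δ :=
      Nat.cast_le.2 (Finset.card_le_card
        (Finset.filter_subset_filter _ (Finset.erase_subset v S)))
    calc _ ≤ δ * (1 / (δ * (δ + 1))) := by gcongr
      _ ≤ 1 / (δ + 1) := by
        rcases hδ0.eq_or_lt with h | h
        · rw [← h]; norm_num
        · apply le_of_eq; field_simp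
  calc _ ≤ _ := Finset.sum_le_sum hpt
    _ ≤ _ := by
      rw [Finset.sum_add_distrib, ← Finset.sum_erase_add S _ hv]
      gcongr

variable [Fintype V]

lemma edgesIn_le_edgesIn_erase_add (S : Finset V) (v : V) :
    edgesIn G S ≤ edgesIn G (S.erase v) + degIn G S v := by
  unfold edgesIn degIn
  refine (Finset.card_le_card ?_).trans ((Finset.card_union_le _ _).trans
    (Nat.add_le_add_left (Finset.card_image_le (f := fun u => s(v, u))) _))
  intro e he
  rw [Finset.mem_filter] at he
  obtain ⟨heG, heS⟩ := he
  rw [Finset.mem_union]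
  by_cases hve : v ∈ e
  · right
    obtain ⟨u, rfl⟩ := Sym2.mem_iff_exists.1 hve
    refine Finset.mem_image.2 ⟨u, Finset.mem_filter.2 ⟨heS u (Sym2.mem_mk_right v u), ?_⟩, rfl⟩
    simpa using heG
  · left
    refine Finset.mem_filter.2 ⟨heG, fun w hw => Finset.mem_erase.2 ⟨?_, heS w hw⟩⟩
    rintro rfl
    exact hve hw

/-- Greedily deleting minimum-degree vertices reaches a set of minimum degree at least `d`,
losing at most `d` edges per deleted vertex and not increasing `∑ 1 / (deg + 1)`. -/
lemma exists_degree_core (d : ℝ) (S : Finset V) :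
    ∃ T ⊆ S, (∀ v ∈ T, d ≤ (degIn G T v : ℝ)) ∧
      (edgesIn G S : ℝ) ≤ edgesIn G T + d * ((S.card : ℝ) - T.card) ∧
      ∑ v ∈ T, 1 / ((degIn G T v : ℝ) + 1) ≤ ∑ v ∈ S, 1 / ((degIn G S v : ℝ) + 1) := by
  induction S using Finset.strongInduction with
  | H S ih =>
    by_cases hS : ∀ v ∈ S, d ≤ (degIn G S v : ℝ)
    · exact ⟨S, Finset.Subset.refl S, hS, by simp, le_rfl⟩
    · push Not at hS
      obtain ⟨w, hw, hwd⟩ := hS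
      obtain ⟨v, hv, hmin⟩ := Finset.exists_min_image S (degIn G S) ⟨w, hw⟩
      obtain ⟨T, hTS, hT, hedge, hsum⟩ := ih _ (Finset.erase_ssubset hv)
      refine ⟨T, hTS.trans (Finset.erase_subset v S), hT, ?_,
        hsum.trans (sum_inv_degIn_erase_le G hv hmin)⟩
      have hvd : (degIn G S v : ℝ) ≤ d :=
        (Nat.cast_le.2 (hmin w hw)).trans hwd.le
      have herase : (edgesIn G S : ℝ) ≤ edgesIn G (S.erase v) + degIn G S v := by
        exact_mod_cast edgesIn_le_edgesIn_erase_add G S v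
      have hcard : ((S.erase v).card : ℝ) + 1 = S.card := by
        exact_mod_cast Finset.card_erase_add_one hv
      rw [← hcard]
      linarith

lemma edgesIn_le_Emax (S : Finset V) : (edgesIn G S : ℝ) ≤ Emax (Fintype.card V) := by
  have h : edgesIn G S ≤ (Fintype.card V).choose 2 :=
    (Finset.card_filter_le _ _).trans G.card_edgeFinset_le_card_choose_two
  rw [Emax, ← Nat.cast_choose_two]
  exact_mod_cast h

lemma nonempty_of_edgesIn_pos {S : Finset V} (h : 0 < edgesIn G S) : S.Nonempty := by
  obtain ⟨e, he⟩ := Finset.card_pos.1 h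
  induction e with
  | h x y => exact ⟨x, (Finset.mem_filter.1 he).2 x (Sym2.mem_mk_left x y)⟩

end DegreeCore

section LeftTerm

variable {V : Type*} (G : SimpleGraph V) {c : ℝ} {S : Finset V}

lemma Lobj_le_Lrel (hc : 0 ≤ c) (hdeg : ∀ v ∈ S, 1 ≤ degIn G S v) :
    Lobj G c S ≤ Lrel G c S := by
  unfold Lobj Lrel
  gcongr with v hv
  · exact_mod_cast hdeg v hv
  · linarith

lemma Lrel_sub_le_Lobj (hc : c ∈ Set.Icc (0 : ℝ) 1) {d : ℝ} (hd : 0 < d)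
    (hdeg : ∀ v ∈ S, d ≤ (degIn G S v : ℝ)) :
    Lrel G c S - S.card * (1 / d ^ 2) ≤ Lobj G c S := by
  have hsum : ∑ v ∈ S, c / (degIn G S v : ℝ) ≤
      ∑ v ∈ S, (c / ((degIn G S v : ℝ) + 1) + 1 / d ^ 2) := by
    refine Finset.sum_le_sum fun v hv => ?_
    have hx := hdeg v hv
    generalize (degIn G S v : ℝ) = x at hx
    have hx0 : 0 < x := hd.trans_le hx
    have hsub : c / x - c / (x + 1) = c / (x * (x + 1)) := by field_simp; ring
    have hmono : c / (x * (x + 1)) ≤ 1 / d ^ 2 := by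
      apply div_le_div₀ zero_le_one hc.2 (by positivity)
      nlinarith
    linarith
  rw [Finset.sum_add_distrib, Finset.sum_const, nsmul_eq_mul] at hsum
  unfold Lobj Lrel
  linarith

end LeftTerm

/-- Let `ε ∈ (0,1/7]`, `c ∈ [0,1]`, `G` a simple graph on
`n ≥ 324/ε⁸` vertices, and `S ⊆ V` with `deg_S(v) ≥ 1` for all `v ∈ S` and
`μ_p(S) ≥ ε`. Then there exists `T ⊆ S` such that every `v ∈ T` has
`deg_T(v) ≥ ε·n/3`, `|T| ≥ ε·n/3`, and `μ_p(T) ≥ μ_p(S) − 2ε`. -/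
theorem stmt_14 {V : Type*} [Fintype V] (G : SimpleGraph V) (ε c : ℝ)
    (hε : ε ∈ Set.Ioc (0:ℝ) (1/7)) (hc : c ∈ Set.Icc (0:ℝ) 1)
    (hn : 324 / ε ^ 8 ≤ (Fintype.card V : ℝ))
    (S : Finset V) (hdeg : ∀ v ∈ S, 1 ≤ degIn G S v)
    (hμ : ε ≤ muP G c S) :
    ∃ T ⊆ S,
      (∀ v ∈ T, ε * (Fintype.card V : ℝ) / 3 ≤ (degIn G T v : ℝ)) ∧
      ε * (Fintype.card V : ℝ) / 3 ≤ (T.card : ℝ) ∧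
      muP G c S - 2 * ε ≤ muP G c T := by
  obtain ⟨hε0, hε7⟩ := hε
  set N : ℝ := (Fintype.card V : ℝ)
  have hNε : 324 ≤ N * ε ^ 8 := (div_le_iff₀ (by positivity)).1 hn
  have hN0 : 0 ≤ N := Nat.cast_nonneg _
  have hε1 : ε ≤ 1 := by linarith
  have hN3 : 324 ≤ N * ε ^ 3 := hNε.trans
    (mul_le_mul_of_nonneg_left (pow_le_pow_of_le_one hε0.le hε1 (by norm_num)) hN0)
  have hN1 : 324 ≤ N := hNε.trans (mul_le_of_le_one_right hN0 (pow_le_one₀ hε0.le hε1))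
  set d : ℝ := ε * N / 3 with hd
  have hd0 : 0 < d := by positivity
  have hE : Emax (Fintype.card V) = N * (N - 1) / 2 := rfl
  have hE0 : 0 < Emax (Fintype.card V) := by
    rw [hE]
    exact div_pos (mul_pos (by linarith) (by linarith)) two_pos
  obtain ⟨T, hTS, hT, hedge, hsum⟩ := exists_degree_core G d S
  have hR : ∀ X : Finset V, 0 ≤ Robj G X ∧ Robj G X ≤ 1 := fun X =>
    ⟨div_nonneg (Nat.cast_nonneg _) hE0.le, (div_le_one hE0).2 (edgesIn_le_Emax G X)⟩
  have hLS1 : Lobj G c S ≤ 1 :=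
    sub_le_self _ (Finset.sum_nonneg fun v _ => div_nonneg hc.1 (Nat.cast_nonneg _))
  have hLS0 : 0 < Lobj G c S :=
    pos_of_mul_pos_left (hε0.trans_le hμ) (hR S).1
  have hRS : ε ≤ Robj G S := hμ.trans (mul_le_of_le_one_left (hR S).1 hLS1)
  have hRT : Robj G S - ε < Robj G T := by
    have hcard : (S.card : ℝ) ≤ N := Nat.cast_le.2 (Finset.card_le_univ S)
    have hloss : d * ((S.card : ℝ) - T.card) ≤ d * N := by
      gcongr
      linarith [(Nat.cast_nonneg T.card : (0 : ℝ) ≤ T.card)]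
    have hlt : d * N < ε * Emax (Fintype.card V) := by
      rw [hE, hd]
      have : 0 < ε * N * (N - 3) := mul_pos (by positivity) (by linarith)
      nlinarith
    rw [Robj, Robj, sub_lt_iff_lt_add, div_lt_iff₀ hE0, add_mul, div_mul_cancel₀ _ hE0.ne']
    linarith
  have hLT : Lobj G c S - ε ≤ Lobj G c T := by
    have hrel : Lrel G c S ≤ Lrel G c T := by
      unfold Lrel
      have := mul_le_mul_of_nonneg_left hsum hc.1
      simp only [Finset.mul_sum, mul_one_div] at this
      linarith
    have hcard : (T.card : ℝ) ≤ N := Nat.cast_le.2 (Finset.card_le_univ T)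
    have hgap : (T.card : ℝ) * (1 / d ^ 2) ≤ ε := by
      rw [mul_one_div, div_le_iff₀ (by positivity), hd]
      have : N * 324 ≤ N * (N * ε ^ 3) := by gcongr
      nlinarith
    linarith [Lobj_le_Lrel G hc.1 hdeg, Lrel_sub_le_Lobj G hc hd0 hT]
  refine ⟨T, hTS, hT, ?_, ?_⟩
  · have hpos : 0 < edgesIn G T := by
      rw [Nat.pos_iff_ne_zero]
      intro h0
      have : Robj G T = 0 := by simp [Robj, h0]
      linarith
    obtain ⟨v, hv⟩ := nonempty_of_edgesIn_pos G hpos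
    exact (hT v hv).trans (Nat.cast_le.2 (degIn_le_card G T v))
  · have hL := mul_le_mul_of_nonneg_right hLT (hR T).1
    have hRmul := mul_le_mul_of_nonneg_left hRT.le hLS0.le
    have hεR := mul_le_mul_of_nonneg_left (hR T).2 hε0.le
    have hεL := mul_le_mul_of_nonneg_right hLS1 hε0.le
    unfold muP
    linarith
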